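/- arXiv:2605.28962 — 3 statements merged into one kernel-verified Lean document; each statement's English description precedes it below -/
import Mathlib

section
/- Let α ∈ (0,1) and k ∈ ℝ, and let s, t be real numbers with (1−α)/(2−α) ≤ s ≤ t ≤ 1. Then (k·s·(1−s))² ≥ (k·s^α·t^(1−α)·(1−t))², where powers denote real powers. Consequently the first-stage sampling standard deviation σ_t = √((k s(1−s))² − (k s^α t^(1−α)(1−t))²) is well-defined (the expression under the square root is nonnegative) whenever s ≥ (1−α)/(2−α). -/
theorem antitoneOn_rpow_mul_one_sub {β : ℝ} (hβ₀ : 0 < β) (hβ₁ : β ≤ 1) :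
    AntitoneOn (fun u : ℝ => u ^ β * (1 - u)) (Set.Icc (β / (1 + β)) 1) := by
  rintro s ⟨hs, -⟩ t ⟨-, ht⟩ hst
  have hs₀ : 0 < s := lt_of_lt_of_le (by positivity) hs
  rw [div_le_iff₀ (by positivity)] at hs
  have bernoulli : (t / s) ^ β ≤ 1 + β * (t / s - 1) := by
    have h := rpow_one_add_le_one_add_mul_self (s := t / s - 1)
      (by linarith [div_nonneg (hs₀.le.trans hst) hs₀.le]) hβ₀.le hβ₁
    rwa [add_sub_cancel] at h
  have tangent : (1 + β * (t / s - 1)) * (1 - t) ≤ 1 - s := by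
    have hgap : 1 - s - (1 + β * (t / s - 1)) * (1 - t)
        = (t - s) * (s - β * (1 - t)) / s := by
      field_simp
      ring
    have : 0 ≤ (t - s) * (s - β * (1 - t)) / s :=
      div_nonneg (mul_nonneg (by linarith) (by nlinarith)) hs₀.le
    linarith
  calc t ^ β * (1 - t) = s ^ β * ((t / s) ^ β * (1 - t)) := by
        rw [← mul_assoc, ← Real.mul_rpow hs₀.le (div_nonneg (hs₀.le.trans hst) hs₀.le),
          mul_div_cancel₀ _ hs₀.ne']
    _ ≤ s ^ β * (1 - s) := by
        gcongr
        exact (mul_le_mul_of_nonneg_right bernoulli (by linarith)).trans tangent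

/-- Nonnegativity of the radicand of the first-stage NADB sampling standard deviation:
for `α ∈ (0,1)`, `k ∈ ℝ` and `(1−α)/(2−α) ≤ s ≤ t ≤ 1`,
`(k·s·(1−s))² ≥ (k·s^α·t^(1−α)·(1−t))²`, so
`σ_t = √((k s(1−s))² − (k s^α t^(1−α)(1−t))²)` is well-defined. -/
theorem nadb_first_stage_variance_nonneg
    (α k s t : ℝ) (hα : α ∈ Set.Ioo (0:ℝ) 1)
    (hds : (1 - α) / (2 - α) ≤ s) (hst : s ≤ t) (ht : t ≤ 1) :
    (k * s^α * t ^ (1 - α) * (1 - t)) ^ 2 ≤ (k * s * (1 - s)) ^ 2 := by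
  obtain ⟨hα₀, hα₁⟩ := hα
  have hs₀ : 0 < s := lt_of_lt_of_le (div_pos (by linarith) (by linarith)) hds
  have hds' : (1 - α) / (1 + (1 - α)) ≤ s := by
    convert hds using 2
    ring
  have hmono : t ^ (1 - α) * (1 - t) ≤ s ^ (1 - α) * (1 - s) :=
    antitoneOn_rpow_mul_one_sub (by linarith) (by linarith)
      ⟨hds', hst.trans ht⟩ ⟨hds'.trans hst, ht⟩ hst
  have hsplit : s ^ α * s ^ (1 - α) = s := by
    rw [← Real.rpow_add hs₀, add_sub_cancel, Real.rpow_one]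
  have hle : s ^ α * (t ^ (1 - α) * (1 - t)) ≤ s * (1 - s) :=
    calc s ^ α * (t ^ (1 - α) * (1 - t)) ≤ s ^ α * (s ^ (1 - α) * (1 - s)) := by gcongr
      _ = s * (1 - s) := by rw [← mul_assoc, hsplit]
  have hnonneg : 0 ≤ s ^ α * (t ^ (1 - α) * (1 - t)) :=
    mul_nonneg (Real.rpow_nonneg hs₀.le _)
      (mul_nonneg (Real.rpow_nonneg (hs₀.le.trans hst) _) (by linarith))
  calc (k * s ^ α * t ^ (1 - α) * (1 - t)) ^ 2
      = k ^ 2 * (s ^ α * (t ^ (1 - α) * (1 - t))) ^ 2 := by ring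
    _ ≤ k ^ 2 * (s * (1 - s)) ^ 2 := by gcongr
    _ = (k * s * (1 - s)) ^ 2 := by ring
end

section
/- Let α ∈ (0,1) and define f : ℝ → ℝ by f(u) = u^(1−α)·(1−u), with the real power u^(1−α). Then f is strictly antitone (strictly decreasing) on the interval [(1−α)/(2−α), 1]. -/
/-- For `α ∈ (0,1)`, the target noise profile `f(u) = u^(1−α)·(1−u)` is strictly
decreasing on `[(1−α)/(2−α), 1]`. -/
theorem nadb_noise_profile_strictAnti
    (α : ℝ) (hα : α ∈ Set.Ioo (0:ℝ) 1) :
    StrictAntiOn (fun u : ℝ => u ^ (1 - α) * (1 - u))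
      (Set.Icc ((1 - α) / (2 - α)) 1) := by
  obtain ⟨-, hα1⟩ := hα
  have h2 : 0 < 2 - α := by linarith
  refine strictAntiOn_of_deriv_neg (convex_Icc _ _) ?_ fun u hu => ?_
  · exact ((Real.continuous_rpow_const (by linarith)).mul (by fun_prop)).continuousOn
  · rw [interior_Icc] at hu
    have hu0 : 0 < u := (div_pos (by linarith) h2).trans hu.1
    have hlt : 1 - α < u * (2 - α) := (div_lt_iff₀ h2).1 hu.1
    have hderiv : HasDerivAt (fun u : ℝ => u ^ (1 - α) * (1 - u))
        ((1 - α) * u ^ (1 - α - 1) * (1 - u) + u ^ (1 - α) * (-1)) u :=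
      (Real.hasDerivAt_rpow_const (Or.inl hu0.ne')).mul ((hasDerivAt_id' u).const_sub 1)
    have hpow : u ^ (1 - α) = u ^ (1 - α - 1) * u := by
      rw [← Real.rpow_add_one hu0.ne', sub_add_cancel]
    rw [hderiv.deriv, hpow]
    calc (1 - α) * u ^ (1 - α - 1) * (1 - u) + u ^ (1 - α - 1) * u * (-1)
        = u ^ (1 - α - 1) * (1 - α - u * (2 - α)) := by ring
      _ < 0 := mul_neg_of_pos_of_neg (Real.rpow_pos_of_pos hu0 _) (sub_neg.2 hlt)
end

section
/- Let V be a real vector space, α ∈ (0,1), k ∈ ℝ, w ∈ ℝ, and 0 < s ≤ t ≤ 1. Let X₀, X̂₀, Z ∈ V, define X_t = (1 − t^α)·X₀ + t^α·X̂₀ + k·t·(1−t)·Z and ε = t^(−α)·(X_t − X₀). Define the coefficients a = t^α·(w + s^α − 1 − w·t^α), b = s^α − 1 − w·t^α, and c = s^α − w·t^α. Then a·ε − b·X_t + c·X̂₀ = (1 − s^α)·X₀ + s^α·X̂₀ + w·k·t·(1−t)·Z. -/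
/-- Deterministic part of the second-stage (endpoint-conditioned) NADB reverse sampling
update: with `X_t = (1−t^α)·X₀ + t^α·X̂₀ + k·t·(1−t)·Z`, `ε = (X_t − X₀)/t^α`, and
coefficients `a = t^α(w + s^α − 1 − w t^α)`, `b = s^α − 1 − w t^α`, `c = s^α − w t^α`,
one has `a·ε − b·X_t + c·X̂₀ = (1−s^α)·X₀ + s^α·X̂₀ + w·k·t·(1−t)·Z`. -/
theorem nadb_second_stage_step
    {V : Type*} [AddCommGroup V] [Module ℝ V]
    (α k w s t : ℝ) (hα : α ∈ Set.Ioo (0:ℝ) 1)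
    (hs : 0 < s) (hst : s ≤ t) (ht : t ≤ 1)
    (X₀ Xhat₀ Z Xt ε : V) (a b c : ℝ)
    (hXt : Xt = (1 - t ^ α) • X₀ + (t ^ α) • Xhat₀ + (k * t * (1 - t)) • Z)
    (hε : ε = (t ^ (-α)) • (Xt - X₀))
    (ha : a = t ^ α * (w + s ^ α - 1 - w * t ^ α))
    (hb : b = s ^ α - 1 - w * t ^ α)
    (hc : c = s ^ α - w * t ^ α) :
    a • ε - b • Xt + c • Xhat₀ =
      (1 - s ^ α) • X₀ + (s ^ α) • Xhat₀ + (w * (k * t * (1 - t))) • Z := by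
  have ht₀ : 0 < t := hs.trans_le hst
  have haε : a • ε = (w + b) • (Xt - X₀) := by
    rw [hε, smul_smul, ha, hb, Real.rpow_neg ht₀.le]
    congr 1
    field_simp [(Real.rpow_pos_of_pos ht₀ α).ne']
    ring
  rw [haε, hXt, hb, hc]
  module
end
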